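/- arXiv:2002.12028 — 2 statements merged into one kernel-verified Lean document; each statement's English description precedes it below -/
import Mathlib

section
/- Let h ≠ 0, γ ≠ 0 be reals, J a real N×N matrix, F : ℝ^N → ℝ^N, U_n ∈ ℝ^N. Let α = (α_{ij}) ∈ ℝ^{s×s} be strictly lower triangular, Γ = (γ_{ij}) ∈ ℝ^{s×s} lower triangular with all diagonal entries γ_{ii} = γ, and b ∈ ℝ^s. Define a = α Γ⁻¹, c = γ⁻¹I - Γ⁻¹, m = bᵀΓ⁻¹ (so a and c are strictly lower triangular), and set S_i = Σ_{j≤i} γ_{ij} K_j. If the vectors K_1, …, K_s ∈ ℝ^N satisfy the ROW stage equations (I - hγ J)K_i = hF(U_n + Σ_{j<i} α_{ij}K_j) + hJ Σ_{j<i} γ_{ij}K_j for i = 1, …, s, then the transformed vectors S_i satisfy ((hγ)⁻¹ I - J) S_i = F(U_n + Σ_{j<i} a_{ij}S_j) + Σ_{j<i} (c_{ij}/h) S_j for i = 1, …, s, and moreover Σ_{i=1}^s m_i S_i = Σ_{i=1}^s b_i K_i, so both formulations produce the same update U_{n+1}. -/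
open Matrix Finset

/-- A sum over a finset containing the support of a row of `A` is that row of the product `A * X`. -/
theorem sum_smul_row_eq_mul {s N : ℕ} (A : Matrix (Fin s) (Fin s) ℝ) (X : Fin s → Fin N → ℝ)
    (i : Fin s) (t : Finset (Fin s)) (hA : ∀ j, j ∉ t → A i j = 0) :
    ∑ j ∈ t, A i j • X j = (A * Matrix.of X) i := by
  rw [Finset.sum_subset (Finset.subset_univ t) fun j _ hj => by rw [hA j hj, zero_smul]]
  ext n
  simp [Matrix.mul_apply, Finset.sum_apply]

/-- The inverse of an invertible lower triangular matrix is lower triangular. -/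
theorem inv_apply_eq_zero_of_lt {s : ℕ} (L : Matrix (Fin s) (Fin s) ℝ) (hdet : IsUnit L.det)
    (hlow : ∀ i j : Fin s, i < j → L i j = 0) (i j : Fin s) (hij : i < j) : L⁻¹ i j = 0 := by
  let _ : Invertible L := L.invertibleOfIsUnitDet hdet
  have hL : L.BlockTriangular OrderDual.toDual := fun i j hij => hlow i j hij
  exact Matrix.blockTriangular_inv_of_blockTriangular hL hij

/-- The diagonal of the inverse of an invertible lower triangular matrix. -/
theorem diag_mul_inv_diag_of_lower {s : ℕ} (L : Matrix (Fin s) (Fin s) ℝ) (hdet : IsUnit L.det)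
    (hlow : ∀ i j : Fin s, i < j → L i j = 0) (i : Fin s) : L i i * L⁻¹ i i = 1 := by
  have h := congrFun (congrFun (L.mul_nonsing_inv hdet) i) i
  rw [Matrix.mul_apply, Matrix.one_apply_eq, Finset.sum_eq_single i] at h
  · exact h
  · intro j _ hj
    rcases lt_or_gt_of_ne hj with hj | hj
    · rw [inv_apply_eq_zero_of_lt L hdet hlow j i hj, mul_zero]
    · rw [hlow i j hj, zero_mul]
  · simp

/-- Transformation of a ROW method to the form without matrix–vector
multiplications: with `a = αΓ⁻¹`, `c = γ⁻¹I - Γ⁻¹`, `m = bᵀΓ⁻¹` and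
`S_i = Σ_{j≤i} γ_{ij} K_j`, the ROW stage equations
`(I - hγJ)K_i = hF(U_n + Σ_{j<i} α_{ij}K_j) + hJ Σ_{j<i} γ_{ij}K_j`
imply the transformed equations
`((hγ)⁻¹I - J)S_i = F(U_n + Σ_{j<i} a_{ij}S_j) + Σ_{j<i} (c_{ij}/h)S_j`,
and `Σ m_i S_i = Σ b_i K_i`, so both formulations give the same update. -/
theorem row_method_transformed_formulation
    (N s : ℕ) (h γ : ℝ) (hh : h ≠ 0) (hγ : γ ≠ 0)
    (J : Matrix (Fin N) (Fin N) ℝ) (F : (Fin N → ℝ) → (Fin N → ℝ))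
    (Un : Fin N → ℝ)
    (α Γ : Matrix (Fin s) (Fin s) ℝ)
    (hα : ∀ i j : Fin s, i ≤ j → α i j = 0)
    (hΓlow : ∀ i j : Fin s, i < j → Γ i j = 0)
    (hΓdiag : ∀ i : Fin s, Γ i i = γ)
    (b : Fin s → ℝ)
    (a c : Matrix (Fin s) (Fin s) ℝ) (m : Fin s → ℝ)
    (ha : a = α * Γ⁻¹) (hc : c = γ⁻¹ • (1 : Matrix (Fin s) (Fin s) ℝ) - Γ⁻¹)
    (hm : m = Γ⁻¹.vecMul b)
    (K S : Fin s → (Fin N → ℝ))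
    (hS : ∀ i : Fin s, S i = ∑ j ∈ Finset.Iic i, Γ i j • K j)
    (hstage : ∀ i : Fin s,
      (1 - (h * γ) • J).mulVec (K i) =
        h • F (Un + ∑ j ∈ Finset.Iio i, α i j • K j) +
          h • J.mulVec (∑ j ∈ Finset.Iio i, Γ i j • K j)) :
    (∀ i : Fin s,
      ((h * γ)⁻¹ • (1 : Matrix (Fin N) (Fin N) ℝ) - J).mulVec (S i) =
        F (Un + ∑ j ∈ Finset.Iio i, a i j • S j) +
          ∑ j ∈ Finset.Iio i, (c i j / h) • S j) ∧
    (∑ i, m i • S i) = ∑ i, b i • K i := by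
  have hdet : IsUnit Γ.det := by
    rw [Matrix.det_of_isLowerTriangular Γ fun i j hij => hΓlow i j hij]
    simp [hΓdiag, hγ]
  have hinv := inv_apply_eq_zero_of_lt Γ hdet hΓlow
  have hdiag : ∀ i, Γ⁻¹ i i = γ⁻¹ := fun i =>
    eq_inv_of_mul_eq_one_right (hΓdiag i ▸ diag_mul_inv_diag_of_lower Γ hdet hΓlow i)
  have ha_low : ∀ i j : Fin s, i ≤ j → a i j = 0 := by
    intro i j hij
    rw [ha, Matrix.mul_apply]
    refine Finset.sum_eq_zero fun k _ => ?_
    rcases le_or_gt i k with hk | hk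
    · rw [hα i k hk, zero_mul]
    · rw [hinv k j (hk.trans_le hij), mul_zero]
  have hc_low : ∀ i j : Fin s, i ≤ j → c i j = 0 := by
    intro i j hij
    rw [hc]
    rcases hij.eq_or_lt with rfl | hij
    · simp [hdiag]
    · simp [hinv i j hij, hij.ne]
  have hSK : Matrix.of S = Γ * Matrix.of K := by
    ext i n
    rw [Matrix.of_apply, hS, sum_smul_row_eq_mul Γ K i _ (by simpa using hΓlow i)]
  have hKS : Γ⁻¹ * Matrix.of S = Matrix.of K := by
    rw [hSK, Matrix.nonsing_inv_mul_cancel_left _ _ hdet]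
  refine ⟨fun i => ?_, ?_⟩
  · have haS : ∑ j ∈ Finset.Iio i, a i j • S j = ∑ j ∈ Finset.Iio i, α i j • K j := by
      rw [sum_smul_row_eq_mul a S i _ (by simpa using ha_low i),
        sum_smul_row_eq_mul α K i _ (by simpa using hα i), ha, Matrix.mul_assoc, hKS]
    have hcS : ∑ j ∈ Finset.Iio i, (c i j / h) • S j = h⁻¹ • (γ⁻¹ • S i - K i) := by
      have hrow : ∑ j ∈ Finset.Iio i, c i j • S j = γ⁻¹ • S i - K i := by
        rw [sum_smul_row_eq_mul c S i _ (by simpa using hc_low i), hc, Matrix.sub_mul, hKS,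
          Matrix.smul_mul, Matrix.one_mul]
        rfl
      rw [← hrow, Finset.smul_sum]
      exact Finset.sum_congr rfl fun j _ => by rw [smul_smul, div_eq_inv_mul]
    have hSi : ∑ j ∈ Finset.Iio i, Γ i j • K j = S i - γ • K i := by
      rw [hS, ← Finset.Iio_insert, Finset.sum_insert (by simp), hΓdiag, add_sub_cancel_left]
    have hst := hstage i
    rw [hSi, Matrix.sub_mulVec, Matrix.one_mulVec, Matrix.smul_mulVec, Matrix.mulVec_sub,
      Matrix.mulVec_smul] at hst
    rw [haS, hcS, Matrix.sub_mulVec, Matrix.smul_mulVec, Matrix.one_mulVec]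
    ext n
    have hn := congrFun hst n
    simp only [Pi.sub_apply, Pi.add_apply, Pi.smul_apply, smul_eq_mul] at hn ⊢
    field_simp
    linear_combination γ * hn
  · have hvec : ∀ (v : Fin s → ℝ) (X : Fin s → Fin N → ℝ),
        ∑ i, v i • X i = v ᵥ* Matrix.of X := by
      intro v X
      ext n
      simp [Matrix.vecMul, dotProduct, Finset.sum_apply]
    rw [hvec, hvec, hm, Matrix.vecMul_vecMul, hKS]
end

section
/- Let B ∈ ℝ^{s×s} be a lower triangular matrix with nonzero diagonal entries and b ∈ ℝ^s. Then the real stability function R(x) = 1 + x bᵀ (I - xB)⁻¹ 𝟙 tends to 1 - bᵀ B⁻¹ 𝟙 as x → -∞. In particular, if b equals the s-th row of B (the stiff accuracy condition b_i = α_{si} + γ_{si} for all i), then R(x) → 0 as x → -∞, so a stiffly accurate A-stable ROW method is L-stable. -/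
open Matrix Filter

/-- The rescaled resolvent `x (1 - x B)⁻¹` of an invertible matrix tends to `-B⁻¹` at `-∞`. -/
theorem Matrix.tendsto_smul_inv_one_sub_smul_atBot {n : Type*} [Fintype n] [DecidableEq n]
    {B : Matrix n n ℝ} (hB : IsUnit B.det) :
    Tendsto (fun x : ℝ => x • (1 - x • B)⁻¹) atBot (nhds (-B⁻¹)) := by
  have hdet : (-B).det ≠ 0 := by
    simpa [Matrix.det_neg] using hB.ne_zero
  have hlim : Tendsto (fun x : ℝ => x⁻¹ • (1 : Matrix n n ℝ) - B) atBot (nhds (-B)) := by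
    simpa using ((tendsto_inv_atBot_zero (𝕜 := ℝ)).smul_const (1 : Matrix n n ℝ)).sub_const B
  have hdet_lim : Tendsto (fun x : ℝ => (x⁻¹ • (1 : Matrix n n ℝ) - B).det) atBot
      (nhds (-B).det) :=
    ((continuous_id.matrix_det).tendsto (-B)).comp hlim
  have hinv_lim : Tendsto (fun x : ℝ => (x⁻¹ • (1 : Matrix n n ℝ) - B)⁻¹) atBot
      (nhds (-B)⁻¹) := by
    refine Tendsto.comp (continuousAt_matrix_inv (-B) ?_) hlim
    simpa only [Ring.inverse_eq_inv'] using continuousAt_inv₀ hdet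
  have hneg : (-B)⁻¹ = -B⁻¹ := Matrix.inv_eq_right_inv (by simp [Matrix.mul_nonsing_inv B hB])
  rw [← hneg]
  refine hinv_lim.congr' ?_
  filter_upwards [hdet_lim.eventually_ne hdet, eventually_lt_atBot 0] with x hx hx0
  have hfactor : 1 - x • B = x • (x⁻¹ • (1 : Matrix n n ℝ) - B) := by
    rw [smul_sub, smul_inv_smul₀ hx0.ne]
  refine Matrix.inv_eq_right_inv ?_
  rw [mul_smul_comm, ← smul_mul_assoc, ← hfactor]
  refine Matrix.mul_nonsing_inv _ ?_
  rw [hfactor, Matrix.det_smul]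
  exact (mul_ne_zero (pow_ne_zero _ hx0.ne) hx).isUnit

/-- Limit of the ROW stability function at `-∞`: for a lower triangular matrix
`B` with nonzero diagonal and weights `b`, `R(x) = 1 + x bᵀ(I - xB)⁻¹𝟙` tends to
`1 - bᵀB⁻¹𝟙` as `x → -∞`.  If `b` is the last row of `B` (stiff accuracy),
then `R(x) → 0`: a stiffly accurate A-stable ROW method is L-stable. -/
theorem row_stability_function_limit_at_minus_infinity
    (s : ℕ) (B : Matrix (Fin (s + 1)) (Fin (s + 1)) ℝ)
    (hBlow : ∀ i j : Fin (s + 1), i < j → B i j = 0)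
    (hBdiag : ∀ i : Fin (s + 1), B i i ≠ 0)
    (b : Fin (s + 1) → ℝ) :
    Tendsto
        (fun x : ℝ => 1 + x * (b ⬝ᵥ
          (((1 : Matrix (Fin (s + 1)) (Fin (s + 1)) ℝ) - x • B)⁻¹.mulVec
            (fun _ => 1))))
        atBot (nhds (1 - b ⬝ᵥ (B⁻¹.mulVec (fun _ => 1)))) ∧
      ((∀ i, b i = B (Fin.last s) i) →
        Tendsto
          (fun x : ℝ => 1 + x * (b ⬝ᵥ
            (((1 : Matrix (Fin (s + 1)) (Fin (s + 1)) ℝ) - x • B)⁻¹.mulVec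
              (fun _ => 1))))
          atBot (nhds 0)) := by
  have hB : IsUnit B.det := by
    rw [Matrix.det_of_isLowerTriangular B fun i j hij => hBlow i j hij]
    exact (Finset.prod_ne_zero_iff.mpr fun i _ => hBdiag i).isUnit
  have hlim : Tendsto
      (fun x : ℝ => 1 + x * (b ⬝ᵥ
        (((1 : Matrix (Fin (s + 1)) (Fin (s + 1)) ℝ) - x • B)⁻¹.mulVec (fun _ => 1))))
      atBot (nhds (1 - b ⬝ᵥ (B⁻¹.mulVec (fun _ => 1)))) := by
    have hcont : Continuous fun M : Matrix (Fin (s + 1)) (Fin (s + 1)) ℝ =>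
        1 + b ⬝ᵥ M.mulVec (fun _ => 1) := by
      fun_prop
    have h := (hcont.tendsto _).comp (Matrix.tendsto_smul_inv_one_sub_smul_atBot hB)
    simpa [Function.comp_def, Matrix.smul_mulVec, Matrix.neg_mulVec, sub_eq_add_neg] using h
  refine ⟨hlim, fun hb => ?_⟩
  have hrow : b ⬝ᵥ (B⁻¹.mulVec (fun _ => 1)) = 1 := by
    rw [show b = B (Fin.last s) from funext hb]
    change (B.mulVec (B⁻¹.mulVec fun _ => 1)) (Fin.last s) = 1
    rw [Matrix.mulVec_mulVec, Matrix.mul_nonsing_inv B hB, Matrix.one_mulVec]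
  simpa only [hrow, sub_self] using hlim
end
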